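/- Let p ≥ 2 and V = pV_1, the direct sum of p copies of V_1, with coordinates (ℓ_1,…,ℓ_p). Then the invariant ring R = O(V)^{SL(2,ℂ)} is generated as a ℂ-algebra by the C(p,2) degree-2 invariants (ℓ_i,ℓ_j)_1 for 1 ≤ i < j ≤ p, and R possesses a homogeneous system of parameters consisting of 2p − 3 invariants of degree 2. -/

import Mathlib

open MvPolynomial

noncomputable section

namespace BinInv

/-- `k`-fold partial derivative with respect to the variable `v`. -/
def pd {A : Type*} [CommSemiring A] (v : Fin 2) (k : ℕ)
    (f : MvPolynomial (Fin 2) A) : MvPolynomial (Fin 2) A :=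
  (fun g => MvPolynomial.pderiv v g)^[k] f

/-- The `p`-th transvectant of binary forms `g`, `h` of degrees `m`, `n`,
with coefficients in a commutative `ℂ`-algebra `A`. -/
def transvectant {A : Type*} [CommRing A] [Algebra ℂ A] (m n p : ℕ)
    (g h : MvPolynomial (Fin 2) A) : MvPolynomial (Fin 2) A :=
  algebraMap ℂ (MvPolynomial (Fin 2) A)
      ((((m - p).factorial * (n - p).factorial : ℕ) : ℂ) /
        (((m.factorial * n.factorial : ℕ)) : ℂ)) *
    ∑ i ∈ Finset.range (p + 1),
      algebraMap ℂ (MvPolynomial (Fin 2) A) ((-1 : ℂ) ^ i * (p.choose i : ℂ)) *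
        (pd 0 (p - i) (pd 1 i g) * pd 0 i (pd 1 (p - i) h))

variable {p : ℕ}

/-- Index type for the coefficients of a system of binary forms of degrees `n 0, …, n (p-1)`:
the space `V = V_{n 0} ⊕ … ⊕ V_{n (p-1)}` is identified with `Idx n → ℂ`. -/
abbrev Idx (n : Fin p → ℕ) : Type := Σ i : Fin p, Fin (n i + 1)

/-- The binary form of degree `n i` with coefficient vector `c`. -/
def formAt (n : Fin p → ℕ) (c : Idx n → ℂ) (i : Fin p) : MvPolynomial (Fin 2) ℂ :=
  ∑ k : Fin (n i + 1), C (c ⟨i, k⟩) * X 0 ^ (n i - (k : ℕ)) * X 1 ^ (k : ℕ)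

/-- The substitution action of `SL(2,ℂ)` on binary forms: `(g • f)(v) = f (g⁻¹ • v)`. -/
def sl2Act (g : Matrix.SpecialLinearGroup (Fin 2) ℂ) (f : MvPolynomial (Fin 2) ℂ) :
    MvPolynomial (Fin 2) ℂ :=
  aeval (fun i => ∑ j, C ((↑(g⁻¹) : Matrix (Fin 2) (Fin 2) ℂ) i j) * X j) f

/-- The coefficient of `x^(n-k) y^k` in a binary form. -/
def coeffAt (n : Fin p → ℕ) (j : Idx n) (f : MvPolynomial (Fin 2) ℂ) : ℂ :=
  MvPolynomial.coeff
    (Finsupp.single 0 (n j.1 - (j.2 : ℕ)) + Finsupp.single 1 (j.2 : ℕ)) f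

/-- The induced action of `SL(2,ℂ)` on points of `V`, in coefficient coordinates. -/
def actPt (n : Fin p → ℕ) (g : Matrix.SpecialLinearGroup (Fin 2) ℂ) (c : Idx n → ℂ) :
    Idx n → ℂ :=
  fun j => coeffAt n j (sl2Act g (formAt n c j.1))

/-- A polynomial function on `V` is invariant if it is constant on `SL(2,ℂ)`-orbits. -/
def IsInvariant (n : Fin p → ℕ) (P : MvPolynomial (Idx n) ℂ) : Prop :=
  ∀ (g : Matrix.SpecialLinearGroup (Fin 2) ℂ) (c : Idx n → ℂ),
    eval (actPt n g c) P = eval c P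

/-- The invariant ring `R = O(V)^{SL(2,ℂ)}` as a subalgebra of `O(V)`. -/
def invariantRing (n : Fin p → ℕ) : Subalgebra ℂ (MvPolynomial (Idx n) ℂ) where
  carrier := {P | IsInvariant n P}
  mul_mem' := fun ha hb g c => by
    simp only [map_mul]; rw [ha g c, hb g c]
  one_mem' := fun g c => by simp
  add_mem' := fun ha hb g c => by
    simp only [map_add]; rw [ha g c, hb g c]
  zero_mem' := fun g c => by simp
  algebraMap_mem' := fun r g c => by simp

/-- The nullcone: the points of `V` where every homogeneous invariant of positive
degree vanishes. -/
def Nullcone (n : Fin p → ℕ) : Set (Idx n → ℂ) :=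
  {c | ∀ P ∈ invariantRing n, ∀ d : ℕ, 0 < d → P.IsHomogeneous d → eval c P = 0}

/-- `P` is a homogeneous system of parameters of the invariant ring, with degrees `d`:
the `P j` are homogeneous invariants of positive degrees `d j`, algebraically independent
over `ℂ`, and the invariant ring is integral over the subalgebra they generate. -/
def IsHSOP (n : Fin p → ℕ) {k : ℕ} (P : Fin k → MvPolynomial (Idx n) ℂ)
    (d : Fin k → ℕ) : Prop :=
  (∀ j, P j ∈ invariantRing n) ∧ (∀ j, 0 < d j) ∧
    (∀ j, (P j).IsHomogeneous (d j)) ∧ AlgebraicIndependent ℂ P ∧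
    ∀ x ∈ invariantRing n, IsIntegral (↥(Algebra.adjoin ℂ (Set.range P))) x

/-- `r` is the minimal number of generators of the invariant ring. -/
def IsMinimalNumGens (n : Fin p → ℕ) (r : ℕ) : Prop :=
  IsLeast {k | ∃ S : Finset (MvPolynomial (Idx n) ℂ),
    S.card = k ∧ Algebra.adjoin ℂ (S : Set (MvPolynomial (Idx n) ℂ)) = invariantRing n} r

/-- The invariant ring has minimal number of generators `r`, realized by a minimal
system of homogeneous generators of degrees `d 0, …, d (r-1)`. -/
def HasMinimalGens (n : Fin p → ℕ) {r : ℕ} (d : Fin r → ℕ) : Prop :=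
  IsMinimalNumGens n r ∧
    ∃ G : Fin r → MvPolynomial (Idx n) ℂ, Function.Injective G ∧
      (∀ j, (G j).IsHomogeneous (d j)) ∧
      Algebra.adjoin ℂ (Set.range G) = invariantRing n

/-- The generic binary form of degree `n i`, whose coefficients are the corresponding
coordinate functions on `V`. -/
def genForm (n : Fin p → ℕ) (i : Fin p) :
    MvPolynomial (Fin 2) (MvPolynomial (Idx n) ℂ) :=
  ∑ k : Fin (n i + 1), C (X ⟨i, k⟩) * X 0 ^ (n i - (k : ℕ)) * X 1 ^ (k : ℕ)

end BinInv

end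

namespace BinInv

/-- The polynomial ring `O(p·V₁)`. -/
noncomputable abbrev Coord (p : ℕ) : Type := MvPolynomial (Idx (fun _ : Fin p => 1)) ℂ

/-- The coordinate function on `p·V₁` giving the `k`-th coefficient of the `i`-th form. -/
noncomputable def co {p : ℕ} (i : Fin p) (k : Fin 2) : Coord p := X ⟨i, k⟩

/-- The partial derivative with respect to the coordinate function `co i k`. -/
noncomputable def dco {p : ℕ} (i : Fin p) (k : Fin 2) : Derivation ℂ (Coord p) (Coord p) :=
  pderiv ⟨i, k⟩

/-- The bracket `[i j]`, the determinant of the coefficients of the forms `ℓᵢ` and `ℓⱼ`. -/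
noncomputable def bracket {p : ℕ} (i j : Fin p) : Coord p := co i 0 * co j 1 - co i 1 * co j 0

theorem constantCoeff_transvectant_genForm {p : ℕ} (i j : Fin p) :
    constantCoeff (transvectant 1 1 1 (genForm (fun _ => 1) i) (genForm (fun _ => 1) j)) =
      bracket i j := by
  simp [transvectant, genForm, pd, Finset.sum_range_succ, Fin.sum_univ_two, pderiv_X, bracket,
    co, sub_eq_add_neg]

theorem actPt_apply {p : ℕ} (g : Matrix.SpecialLinearGroup (Fin 2) ℂ)
    (c : Idx (fun _ : Fin p => 1) → ℂ) (i : Fin p) (k : Fin 2) :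
    actPt _ g c ⟨i, k⟩ = c ⟨i, 0⟩ * (g⁻¹).1 0 k + c ⟨i, 1⟩ * (g⁻¹).1 1 k := by
  fin_cases k <;>
  simp [actPt, coeffAt, sl2Act, formAt, Fin.sum_univ_two, coeff_C_mul, mul_add, coeff_X,
    Finsupp.single_left_inj]

theorem bracket_mem_invariantRing {p : ℕ} (i j : Fin p) :
    bracket i j ∈ invariantRing (fun _ : Fin p => 1) := by
  intro g c
  have h := (g⁻¹).2
  rw [Matrix.det_fin_two] at h
  simp only [bracket, co, map_sub, map_mul, eval_X, actPt_apply]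
  linear_combination (c ⟨i, 0⟩ * c ⟨j, 1⟩ - c ⟨i, 1⟩ * c ⟨j, 0⟩) * h

/-- The subalgebra generated by the brackets. -/
noncomputable def bracketAlgebra (p : ℕ) : Subalgebra ℂ (Coord p) :=
  Algebra.adjoin ℂ {P | ∃ i j : Fin p, i < j ∧ P = bracket i j}

theorem bracket_mem_bracketAlgebra {p : ℕ} (i j : Fin p) : bracket i j ∈ bracketAlgebra p := by
  rcases lt_trichotomy i j with h | rfl | h
  · exact Algebra.subset_adjoin ⟨i, j, h, rfl⟩
  · rw [show bracket i i = 0 by simp only [bracket]; ring]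
    exact zero_mem _
  · rw [show bracket i j = -bracket j i by simp only [bracket]; ring]
    exact neg_mem (Algebra.subset_adjoin ⟨j, i, h, rfl⟩)

/-- The polarization operator replacing `ℓⱼ` by `ℓᵢ`. -/
noncomputable def polarization {p : ℕ} (i j : Fin p) : Derivation ℂ (Coord p) (Coord p) :=
  co i 0 • dco j 0 + co i 1 • dco j 1

/-- The infinitesimal action of a root vector of `sl₂`: replaces the coefficients with index `l`
by those with index `k`. -/
noncomputable def root {p : ℕ} (k l : Fin 2) : Derivation ℂ (Coord p) (Coord p) :=
  ∑ i, co i k • dco i l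

/-- Cayley's Omega operator in the forms `ℓᵢ` and `ℓⱼ`. -/
noncomputable def omega {p : ℕ} (i j : Fin p) (P : Coord p) : Coord p :=
  dco i 0 (dco j 1 P) - dco i 1 (dco j 0 P)

theorem dco_co {p : ℕ} (i j : Fin p) (k l : Fin 2) :
    dco i k (co j l) = if i = j ∧ k = l then 1 else 0 := by
  classical
  simp only [co, dco, pderiv_X, Pi.single_apply, Sigma.mk.injEq]
  congr 1
  apply propext
  constructor
  · rintro ⟨rfl, h⟩; exact ⟨rfl, (eq_of_heq h).symm⟩
  · rintro ⟨rfl, rfl⟩; exact ⟨rfl, HEq.rfl⟩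

theorem polarization_co {p : ℕ} (i j m : Fin p) (l : Fin 2) :
    polarization i j (co m l) = if j = m then co i l else 0 := by
  fin_cases l <;> simp [polarization, dco_co]

theorem root_apply {p : ℕ} (k l : Fin 2) (P : Coord p) :
    root k l P = ∑ i, co i k * dco i l P := by
  change Derivation.coeFnAddMonoidHom (root k l) P = _
  rw [root, map_sum, Finset.sum_apply]
  rfl

theorem root_co {p : ℕ} (k l : Fin 2) (m : Fin p) (n : Fin 2) :
    root k l (co m n) = if l = n then co m k else 0 := by
  by_cases h : l = n <;>
    simp [root_apply, dco_co, h]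

theorem polarization_mem_bracketAlgebra {p : ℕ} (i j : Fin p) {P : Coord p}
    (hP : P ∈ bracketAlgebra p) : polarization i j P ∈ bracketAlgebra p := by
  induction hP using Algebra.adjoin_induction with
  | mem x hx =>
    obtain ⟨k, l, -, rfl⟩ := hx
    have : polarization i j (bracket k l) =
        (if j = k then bracket i l else 0) + if j = l then bracket k i else 0 := by
      simp only [bracket, map_sub, Derivation.leibniz, polarization_co, smul_eq_mul]
      split_ifs <;> ring
    rw [this]
    refine add_mem ?_ ?_ <;> split_ifs <;>
      first | exact bracket_mem_bracketAlgebra _ _ | exact zero_mem _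
  | algebraMap r => simp
  | add x y _ _ hx hy => rw [map_add]; exact add_mem hx hy
  | mul x y hx' hy' hx hy =>
    rw [Derivation.leibniz, smul_eq_mul, smul_eq_mul]
    exact add_mem (mul_mem hx' hy) (mul_mem hy' hx)

theorem root_polarization_comm {p : ℕ} (k l : Fin 2) (i j : Fin p) (P : Coord p) :
    root k l (polarization i j P) = polarization i j (root k l P) := by
  have : ⁅(root k l : Derivation ℂ (Coord p) (Coord p)), polarization i j⁆ = 0 := by
    refine derivation_ext fun ⟨m, n⟩ => ?_
    change ⁅root k l, polarization i j⁆ (co m n) = (0 : Derivation ℂ (Coord p) (Coord p)) (co m n)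
    rw [Derivation.commutator_apply, root_co, polarization_co]
    by_cases h : l = n <;> by_cases h' : j = m <;> simp [h, h', root_co, polarization_co]
  have h := DFunLike.congr_fun this P
  rwa [Derivation.commutator_apply, Derivation.zero_apply, sub_eq_zero] at h

theorem root_dco {p : ℕ} (k l : Fin 2) (i : Fin p) (n : Fin 2) (P : Coord p) :
    root k l (dco i n P) =
      dco i n (root k l P) - if n = k then dco i l P else 0 := by
  have : ⁅(root k l : Derivation ℂ (Coord p) (Coord p)), dco i n⁆ =
      if n = k then -dco i l else 0 := by
    refine derivation_ext fun ⟨m, r⟩ => ?_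
    change ⁅root k l, dco i n⁆ (co m r) = (if n = k then -dco i l else 0) (co m r)
    rw [Derivation.commutator_apply, root_co, dco_co]
    split_ifs <;> simp_all [dco_co]
  have h := DFunLike.congr_fun this P
  rw [Derivation.commutator_apply] at h
  rw [← sub_eq_iff_eq_add'.mpr (sub_eq_iff_eq_add.mp h)]
  split_ifs <;> simp

theorem root_omega {p : ℕ} {k l : Fin 2} (hkl : k ≠ l) (i j : Fin p) (P : Coord p) :
    root k l (omega i j P) = omega i j (root k l P) := by
  simp only [omega, map_sub, root_dco]
  fin_cases k <;> fin_cases l <;> simp_all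

theorem polarization_apply {p : ℕ} (i j : Fin p) (P : Coord p) :
    polarization i j P = co i 0 * dco j 0 P + co i 1 * dco j 1 P := rfl

/-- The `2 × 2` Capelli identity. -/
theorem capelli {p : ℕ} {i j : Fin p} (hij : i ≠ j) (P : Coord p) :
    polarization i i (polarization j j P) + polarization j j P =
      polarization j i (polarization i j P) + bracket i j * omega i j P := by
  simp only [polarization_apply, map_add, Derivation.leibniz, dco_co, smul_eq_mul, omega, bracket]
  simp only [hij]
  simp
  ring

/-- The polynomials killed by both root vectors of `sl₂`. -/
noncomputable def infinitesimalInvariants (p : ℕ) : Submodule ℂ (Coord p) :=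
  LinearMap.ker (root 0 1 : Derivation ℂ (Coord p) (Coord p)).toLinearMap ⊓
    LinearMap.ker (root 1 0 : Derivation ℂ (Coord p) (Coord p)).toLinearMap

theorem mem_infinitesimalInvariants {p : ℕ} {P : Coord p} :
    P ∈ infinitesimalInvariants p ↔ root 0 1 P = 0 ∧ root 1 0 P = 0 := Iff.rfl

theorem polarization_mem_infinitesimalInvariants {p : ℕ} (i j : Fin p) {P : Coord p}
    (hP : P ∈ infinitesimalInvariants p) : polarization i j P ∈ infinitesimalInvariants p := by
  rw [mem_infinitesimalInvariants] at hP ⊢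
  simp [root_polarization_comm, hP]

theorem omega_mem_infinitesimalInvariants {p : ℕ} (i j : Fin p) {P : Coord p}
    (hP : P ∈ infinitesimalInvariants p) : omega i j P ∈ infinitesimalInvariants p := by
  rw [mem_infinitesimalInvariants] at hP ⊢
  rw [root_omega (by decide), root_omega (by decide), hP.1, hP.2]
  simp [omega]

theorem eval_aeval_polynomial {σ : Type*} (f : σ → Polynomial ℂ) (t : ℂ) (P : MvPolynomial σ ℂ) :
    (aeval f P).eval t = eval (fun x => (f x).eval t) P := by
  induction P using MvPolynomial.induction_on with
  | C a => simp [← algebraMap_eq]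
  | add P Q hP hQ => simp [hP, hQ]
  | mul_X P x hP => simp [hP]

theorem eval_zero_derivative_aeval {p : ℕ} (c : Idx (fun _ : Fin p => 1) → ℂ) (k l : Fin 2)
    (P : Coord p) :
    (Polynomial.derivative (aeval (fun x : Idx (fun _ : Fin p => 1) =>
      Polynomial.C (c x) + if x.2 = l then Polynomial.C (c ⟨x.1, k⟩) * Polynomial.X else 0)
        P)).eval 0 = eval c (root k l P) := by
  induction P using MvPolynomial.induction_on with
  | C a => simp [← algebraMap_eq]
  | add P Q hP hQ => simp [hP, hQ]
  | mul_X P x hP =>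
    obtain ⟨m, n⟩ := x
    have h0 : (aeval (fun x : Idx (fun _ : Fin p => 1) => Polynomial.C (c x) +
        if x.2 = l then Polynomial.C (c ⟨x.1, k⟩) * Polynomial.X else 0) P).eval 0 = eval c P := by
      rw [eval_aeval_polynomial]
      congr 2
      funext x
      split_ifs <;> simp
    change _ = eval c (root k l (P * co m n))
    rw [Derivation.leibniz, root_co, map_mul, Polynomial.derivative_mul, Polynomial.eval_add,
      Polynomial.eval_mul, Polynomial.eval_mul, hP, h0]
    simp only [aeval_X, co, smul_eq_mul, map_add, map_mul, eval_X]
    by_cases h : n = l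
    · subst h
      simp
      ring
    · simp [h, Ne.symm h]
      ring

theorem root_eq_zero_of_eval {p : ℕ} (k l : Fin 2) (P : Coord p)
    (h : ∀ (c : Idx (fun _ : Fin p => 1) → ℂ) (t : ℂ),
      eval (fun x => c x + if x.2 = l then c ⟨x.1, k⟩ * t else 0) P = eval c P) :
    root k l P = 0 := by
  refine MvPolynomial.funext fun c => ?_
  rw [← eval_zero_derivative_aeval, map_zero]
  set q := aeval (fun x : Idx (fun _ : Fin p => 1) => Polynomial.C (c x) +
    if x.2 = l then Polynomial.C (c ⟨x.1, k⟩) * Polynomial.X else 0) P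
  suffices q = Polynomial.C (eval c P) by simp [this]
  refine Polynomial.funext fun t => ?_
  rw [Polynomial.eval_C, ← h c t, eval_aeval_polynomial]
  congr 2
  funext x
  split_ifs <;> simp

theorem exists_inv_coe_eq {M : Matrix (Fin 2) (Fin 2) ℂ} (hM : M.det = 1) :
    ∃ g : Matrix.SpecialLinearGroup (Fin 2) ℂ, (g⁻¹).1 = M := by
  obtain ⟨h, hh⟩ : ∃ h : Matrix.SpecialLinearGroup (Fin 2) ℂ, h.1 = M := ⟨⟨M, hM⟩, rfl⟩
  exact ⟨h⁻¹, by rw [inv_inv, hh]⟩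

theorem invariantRing_le_infinitesimalInvariants {p : ℕ} {P : Coord p}
    (hP : P ∈ invariantRing (fun _ : Fin p => 1)) : P ∈ infinitesimalInvariants p := by
  refine ⟨root_eq_zero_of_eval _ _ _ fun c t => ?_, root_eq_zero_of_eval _ _ _ fun c t => ?_⟩
  · obtain ⟨g, hg⟩ := exists_inv_coe_eq (M := !![1, t; 0, 1]) (by simp)
    rw [← hP g c]
    congr 2
    ext ⟨m, n⟩
    rw [actPt_apply, hg]
    fin_cases n <;> simp [add_comm]
  · obtain ⟨g, hg⟩ := exists_inv_coe_eq (M := !![1, 0; t, 1]) (by simp)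
    rw [← hP g c]
    congr 2
    ext ⟨m, n⟩
    rw [actPt_apply, hg]
    fin_cases n <;> simp [add_comm]

theorem weightedHomogeneousComponent_derivation {σ M : Type*} [AddCommMonoid M] (w : σ → M) (m : M)
    (D : Derivation ℂ (MvPolynomial σ ℂ) (MvPolynomial σ ℂ))
    (hD : ∀ s, IsWeightedHomogeneous w (D (monomial s 1)) (Finsupp.weight w s))
    (P : MvPolynomial σ ℂ) :
    weightedHomogeneousComponent w m (D P) = D (weightedHomogeneousComponent w m P) := by
  classical
  induction P using MvPolynomial.induction_on' with
  | monomial s a =>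
    have hs : monomial s a = a • monomial s (1 : ℂ) := by simp [smul_monomial]
    rw [hs]
    simp only [map_smul, Derivation.map_smul]
    rw [weightedHomogeneousComponent_of_mem (hD s),
      weightedHomogeneousComponent_of_mem (isWeightedHomogeneous_monomial w s (1 : ℂ) rfl)]
    split_ifs <;> simp
  | add P Q hP hQ => simp [hP, hQ]

theorem isWeightedHomogeneous_root {p : ℕ} {M : Type*} [AddCancelCommMonoid M] (w : Fin p → M)
    (k l : Fin 2) (s : Idx (fun _ : Fin p => 1) →₀ ℕ) :
    IsWeightedHomogeneous (fun x => w x.1) (root k l (monomial s (1 : ℂ)))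
      (Finsupp.weight (fun x => w x.1) s) := by
  rw [root_apply]
  refine IsWeightedHomogeneous.sum _ _ _ fun i _ => ?_
  by_cases hs : s ⟨i, l⟩ = 0
  · simp only [dco, pderiv_monomial, hs]
    simpa using isWeightedHomogeneous_zero _ _ _
  · have hle : Finsupp.single ⟨i, l⟩ 1 ≤ s := by
      rw [Finsupp.single_le_iff]
      exact Nat.one_le_iff_ne_zero.mpr hs
    obtain ⟨r, rfl⟩ := exists_add_of_le hle
    rw [map_add, Finsupp.weight_single, one_smul]
    refine (isWeightedHomogeneous_X _ _ _).mul ?_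
    refine IsWeightedHomogeneous.pderiv (isWeightedHomogeneous_monomial _ _ _ rfl) ?_
    rw [map_add, Finsupp.weight_single, one_smul]
    exact add_comm _ _

theorem weightedHomogeneousComponent_mem_infinitesimalInvariants {p : ℕ} {M : Type*}
    [AddCancelCommMonoid M] (w : Fin p → M) (m : M) {P : Coord p}
    (hP : P ∈ infinitesimalInvariants p) :
    weightedHomogeneousComponent (fun x => w x.1) m P ∈ infinitesimalInvariants p := by
  have h (k l : Fin 2) : weightedHomogeneousComponent (fun x => w x.1) m (root k l P) =
      root k l (weightedHomogeneousComponent (fun x => w x.1) m P) :=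
    weightedHomogeneousComponent_derivation _ m _ (isWeightedHomogeneous_root w k l) P
  rw [mem_infinitesimalInvariants] at hP ⊢
  exact ⟨by rw [← h, hP.1, map_zero], by rw [← h, hP.2, map_zero]⟩

/-- The weight counting the degree in the forms different from `ℓₒ`. -/
def offWeight {p : ℕ} (o : Fin p) (x : Idx (fun _ : Fin p => 1)) : ℕ := if x.1 = o then 0 else 1

theorem dco_eq_zero_of_offWeight {p : ℕ} {o j : Fin p} (hj : j ≠ o) (k : Fin 2) {P : Coord p}
    (hP : IsWeightedHomogeneous (offWeight o) P 0) : dco j k P = 0 := by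
  ext m
  rw [dco, coeff_pderiv, hP.coeff_eq_zero]
  · simp
  · rw [map_add, Finsupp.weight_single]
    simp [offWeight, hj]

theorem sum_polarization_of_isHomogeneous {p d : ℕ} {P : Coord p} (hP : P.IsHomogeneous d) :
    ∑ j, polarization j j P = (d : ℂ) • P := by
  have h := hP.sum_X_mul_pderiv
  rw [Fintype.sum_sigma] at h
  rw [Nat.cast_smul_eq_nsmul, ← h]
  exact Finset.sum_congr rfl fun j _ =>
    (Fin.sum_univ_two fun k : Fin 2 => co j k * dco j k P).symm

theorem sum_polarization_of_offWeight {p n : ℕ} {o : Fin p} {P : Coord p}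
    (hP : IsWeightedHomogeneous (offWeight o) P n) :
    ∑ j with j ≠ o, polarization j j P = (n : ℂ) • P := by
  have h := hP.sum_weight_X_mul_pderiv
  rw [Fintype.sum_sigma] at h
  rw [Nat.cast_smul_eq_nsmul, ← h, Finset.sum_filter]
  refine Finset.sum_congr rfl fun j _ => Eq.trans ?_ (Fin.sum_univ_two _).symm
  by_cases hj : j = o <;> simp [hj, offWeight, polarization_apply, co, dco]

theorem offWeight_le_degree {p d n : ℕ} {o : Fin p} {P : Coord p} (hP0 : P ≠ 0)
    (hd : P.IsHomogeneous d) (hn : IsWeightedHomogeneous (offWeight o) P n) : n ≤ d := by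
  obtain ⟨s, hs⟩ := ne_zero_iff.mp hP0
  rw [← hn hs, ← hd hs, Finsupp.weight_apply, Finsupp.weight_apply]
  refine Finset.sum_le_sum fun x _ => ?_
  simp only [offWeight, smul_eq_mul, Pi.one_apply]
  split_ifs <;> simp

theorem isHomogeneous_polarization {p d : ℕ} (i j : Fin p) {P : Coord p} (hP : P.IsHomogeneous d) :
    (polarization i j P).IsHomogeneous d := by
  rcases Nat.eq_zero_or_pos d with rfl | hd
  · rw [← totalDegree_zero_iff_isHomogeneous, totalDegree_eq_zero_iff_eq_C] at hP
    rw [hP, derivation_C]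
    exact isHomogeneous_zero _ _ _
  · have h (k : Fin 2) : (co i k * dco j k P).IsHomogeneous d := by
      have := (isHomogeneous_X ℂ (⟨i, k⟩ : Idx (fun _ : Fin p => 1))).mul
        (hP.pderiv (i := ⟨j, k⟩))
      rwa [Nat.add_sub_cancel' hd] at this
    exact (h 0).add (h 1)

theorem isWeightedHomogeneous_offWeight_dco {p n : ℕ} {o j : Fin p} (hj : j ≠ o) (k : Fin 2)
    {P : Coord p} (hP : IsWeightedHomogeneous (offWeight o) P (n + 1)) :
    IsWeightedHomogeneous (offWeight o) (dco j k P) n :=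
  hP.pderiv (by simp [offWeight, hj])

theorem isWeightedHomogeneous_offWeight_polarization {p n : ℕ} {o j : Fin p} (hj : j ≠ o)
    {P : Coord p} (hP : IsWeightedHomogeneous (offWeight o) P (n + 1)) :
    IsWeightedHomogeneous (offWeight o) (polarization o j P) n := by
  have h (k : Fin 2) : IsWeightedHomogeneous (offWeight o) (co o k * dco j k P) n := by
    have : IsWeightedHomogeneous (offWeight o) (co o k * dco j k P) (offWeight o ⟨o, k⟩ + n) :=
      (isWeightedHomogeneous_X ℂ (offWeight o) ⟨o, k⟩).mul
        (isWeightedHomogeneous_offWeight_dco hj k hP)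
    simpa [offWeight] using this
  exact (h 0).add (h 1)

theorem isWeightedHomogeneous_offWeight_omega {p n : ℕ} {o j : Fin p} (hj : j ≠ o)
    {P : Coord p} (hP : IsWeightedHomogeneous (offWeight o) P (n + 1)) :
    IsWeightedHomogeneous (offWeight o) (omega o j P) n := by
  have h (k l : Fin 2) : IsWeightedHomogeneous (offWeight o) (dco o k (dco j l P)) n := by
    have h' := isWeightedHomogeneous_offWeight_dco hj l hP
    generalize dco j l P = R at h' ⊢
    exact h'.pderiv (by simp [offWeight])
  exact (h 0 1).sub (h 1 0)

theorem mem_bracketAlgebra_of_isHomogeneous {p : ℕ} (o : Fin p) (n : ℕ) :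
    ∀ (d : ℕ) (P : Coord p), P.IsHomogeneous d → IsWeightedHomogeneous (offWeight o) P n →
      P ∈ infinitesimalInvariants p → P ∈ bracketAlgebra p := by
  induction n with
  | zero =>
    intro d P hd hn hP
    have hne (k : Fin 2) : (co o k : Coord p) ≠ 0 := X_ne_zero _
    have hroot (k l : Fin 2) : root k l P = co o k * dco o l P := by
      rw [root_apply, Finset.sum_eq_single o]
      · intro j _ hj
        rw [dco_eq_zero_of_offWeight hj l hn, mul_zero]
      · simp
    rw [mem_infinitesimalInvariants, hroot, hroot] at hP
    have h1 := (mul_eq_zero.mp hP.1).resolve_left (hne 0)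
    have h0 := (mul_eq_zero.mp hP.2).resolve_left (hne 1)
    have hdP := sum_polarization_of_isHomogeneous hd
    rw [Finset.sum_eq_zero] at hdP
    · rcases smul_eq_zero.mp hdP.symm with h | rfl
      · rw [Nat.cast_eq_zero] at h
        subst h
        rw [← totalDegree_zero_iff_isHomogeneous, totalDegree_eq_zero_iff_eq_C] at hd
        rw [hd]
        exact Subalgebra.algebraMap_mem _ _
      · exact zero_mem _
    · intro j _
      rw [polarization_apply]
      by_cases hj : j = o
      · rw [hj, h0, h1, mul_zero, mul_zero, add_zero]
      · rw [dco_eq_zero_of_offWeight hj _ hn, dco_eq_zero_of_offWeight hj _ hn, mul_zero,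
          mul_zero, add_zero]
  | succ n ih =>
    intro d P hd hn hP
    by_cases hP0 : P = 0
    · rw [hP0]; exact zero_mem _
    have hle := offWeight_le_degree hP0 hd hn
    have hoff := sum_polarization_of_offWeight hn
    have hoo : polarization o o P = ((d : ℂ) - (n + 1 : ℕ)) • P := by
      rw [sub_smul, ← hoff, ← sum_polarization_of_isHomogeneous hd, eq_sub_iff_add_eq,
        Finset.filter_ne', Finset.add_sum_erase _ (fun j => polarization j j P) (Finset.mem_univ o)]
    have key : (((n : ℂ) + 1) * (d - n)) • P = ∑ j with j ≠ o,
        (polarization j o (polarization o j P) + bracket o j * omega o j P) := by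
      rw [← Finset.sum_congr rfl fun j hj => capelli (Finset.mem_filter.mp hj).2.symm P,
        Finset.sum_add_distrib, ← map_sum, hoff, Derivation.map_smul, hoo, smul_smul, ← add_smul]
      congr 1
      push_cast
      ring
    have hc : ((n : ℂ) + 1) * (d - n) ≠ 0 := by
      refine mul_ne_zero (Nat.cast_add_one_ne_zero n) ?_
      rw [sub_ne_zero, Nat.cast_injective.ne_iff]
      lia
    rw [← inv_smul_smul₀ hc P, key]
    refine Subalgebra.smul_mem _ (Subalgebra.sum_mem _ fun j hj => ?_) _
    have hj := (Finset.mem_filter.mp hj).2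
    refine add_mem (polarization_mem_bracketAlgebra _ _ (ih d _ (isHomogeneous_polarization _ _ hd)
        (isWeightedHomogeneous_offWeight_polarization hj hn)
        (polarization_mem_infinitesimalInvariants _ _ hP)))
      (mul_mem (bracket_mem_bracketAlgebra _ _) (ih (d - 1 - 1) _ ?_
        (isWeightedHomogeneous_offWeight_omega hj hn) (omega_mem_infinitesimalInvariants _ _ hP)))
    exact (hd.pderiv.pderiv).sub (hd.pderiv.pderiv)

theorem infinitesimalInvariants_le_bracketAlgebra {p : ℕ} (o : Fin p) {P : Coord p}
    (hP : P ∈ infinitesimalInvariants p) : P ∈ bracketAlgebra p := by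
  rw [← sum_weightedHomogeneousComponent (w := (1 : Idx (fun _ : Fin p => 1) → ℕ)) P]
  refine finsum_induction (· ∈ bracketAlgebra p) (zero_mem _) (fun _ _ => add_mem) fun d => ?_
  have hd := weightedHomogeneousComponent_mem_infinitesimalInvariants (fun _ => (1 : ℕ)) d hP
  have hd' : (weightedHomogeneousComponent 1 d P).IsHomogeneous d :=
    weightedHomogeneousComponent_isWeightedHomogeneous d P
  change weightedHomogeneousComponent 1 d P ∈ _ at hd
  generalize weightedHomogeneousComponent 1 d P = R at hd hd'
  rw [← sum_weightedHomogeneousComponent (w := offWeight o) R]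
  refine finsum_induction (· ∈ bracketAlgebra p) (zero_mem _) (fun _ _ => add_mem) fun n => ?_
  refine mem_bracketAlgebra_of_isHomogeneous o n d _ ?_
    (weightedHomogeneousComponent_isWeightedHomogeneous n R)
    (weightedHomogeneousComponent_mem_infinitesimalInvariants
      (fun i => if i = o then 0 else 1) n hd)
  intro s hs
  classical
  rw [coeff_weightedHomogeneousComponent] at hs
  exact hd' fun h => hs (by rw [h, ite_self])

/-- The first fundamental theorem for `SL(2,ℂ)`. -/
theorem bracketAlgebra_eq_invariantRing {p : ℕ} (o : Fin p) :
    bracketAlgebra p = invariantRing (fun _ : Fin p => 1) := by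
  refine le_antisymm (Algebra.adjoin_le ?_) fun P hP =>
    infinitesimalInvariants_le_bracketAlgebra o (invariantRing_le_infinitesimalInvariants hP)
  rintro _ ⟨i, j, -, rfl⟩
  exact bracket_mem_invariantRing i j

theorem isIntegral_of_forall_valuationSubring {R A : Type*} [CommRing R] [CommRing A] [IsDomain A]
    [Algebra R A] (hinj : Function.Injective (algebraMap R A)) {x : A}
    (h : ∀ V : ValuationSubring (FractionRing A),
      (∀ r : R, algebraMap A (FractionRing A) (algebraMap R A r) ∈ V) →
        algebraMap A (FractionRing A) x ∈ V) : IsIntegral R x := by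
  let f : R →+* FractionRing A := (algebraMap A (FractionRing A)).comp (algebraMap R A)
  have hf : Function.Injective f := (IsFractionRing.injective A (FractionRing A)).comp hinj
  have hx : IsIntegral f.range (algebraMap A (FractionRing A) x) := by
    have key := iInf_valuationSubring_superset (s := (f.range : Set (FractionRing A)))
    rw [Subring.closure_eq] at key
    change algebraMap A (FractionRing A) x ∈ (integralClosure f.range (FractionRing A)).toSubring
    rw [← key, Subring.mem_iInf]
    exact fun V => h V.1 fun r => V.2 ⟨r, rfl⟩
  let e : R ≃+* f.range := RingEquiv.ofBijective f.rangeRestrict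
    ⟨fun a b hab => hf (congrArg Subtype.val hab), f.rangeRestrict_surjective⟩
  rw [← isIntegral_algebraMap_iff (IsFractionRing.injective A (FractionRing A))]
  refine hx.map_of_comp_eq (e.symm : f.range →+* R) (RingHom.id _) (RingHom.ext fun y => ?_)
  obtain ⟨r, rfl⟩ := e.surjective y
  rw [RingHom.comp_apply, RingHom.coe_coe, e.symm_apply_apply,
    IsScalarTower.algebraMap_apply R A (FractionRing A)]
  rfl

/-- A valuation bounded by one on the sums of Plücker coordinates `b i j` with fixed `i + j` is
bounded by one on all the Plücker coordinates. -/
theorem valuation_pluecker_le_one {p : ℕ} {K Γ : Type*} [Field K]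
    [LinearOrderedCommGroupWithZero Γ] (v : Valuation K Γ) (b : Fin p → Fin p → K)
    (hanti : ∀ i j, b j i = -b i j)
    (hpluecker : ∀ i j k l, b i j * b k l = b i k * b j l - b i l * b j k)
    (hsum : ∀ i j : Fin p, i < j →
      v (∑ x : Fin p × Fin p with x.1 < x.2 ∧ x.1.val + x.2.val = i.val + j.val,
        b x.1 x.2) ≤ 1) {i j : Fin p} (hij : i < j) : v (b i j) ≤ 1 := by
  classical
  obtain ⟨⟨k, l⟩, hkl, hmax⟩ := Finset.exists_max_image
    (Finset.univ.filter fun x : Fin p × Fin p => x.1 < x.2)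
    (fun x => toLex (v (b x.1 x.2), OrderDual.toDual (x.1.val + x.2.val)))
    ⟨(i, j), by simpa using hij⟩
  have hkl : k < l := by simpa using hkl
  have hmax (m n : Fin p) (hmn : m < n) : v (b m n) < v (b k l) ∨
      v (b m n) = v (b k l) ∧ k.val + l.val ≤ m.val + n.val := by
    have := hmax (m, n) (by simpa using hmn)
    rwa [Prod.Lex.toLex_le_toLex] at this
  have hle (m n : Fin p) (hmn : m < n) : v (b m n) ≤ v (b k l) :=
    (hmax m n hmn).elim le_of_lt fun h => h.1.le
  refine (hle i j hij).trans (not_lt.mp fun hM => ?_)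
  have hlt (m n : Fin p) (hmn : m < n) (h : m.val + n.val < k.val + l.val) :
      v (b m n) < v (b k l) := (hmax m n hmn).resolve_right fun h' => by lia
  have hpos : 0 < v (b k l) := zero_lt_one.trans hM
  have nested (m n q r : Fin p) (hmq : m < q) (hqr : q < r) (hrn : r < n)
      (hs : m.val + n.val = k.val + l.val) (h1 : v (b m n) = v (b k l))
      (h2 : v (b q r) = v (b k l)) : False := by
    have h := congrArg v (hpluecker m n q r)
    rw [map_mul, h1, h2] at h
    have hprod (x y z w : Fin p) (hxy : x < y) (hs : x.val + y.val < k.val + l.val)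
        (hzw : z < w) : v (b x y * b w z) < v (b k l) * v (b k l) := by
      rw [map_mul, hanti z w, v.map_neg]
      exact (mul_le_mul_right (hle z w hzw) _).trans_lt
        (mul_lt_mul_of_pos_right (hlt x y hxy hs) hpos)
    exact (h.trans_lt ((v.map_sub _ _).trans_lt
      (max_lt (hprod m q r n hmq (by lia) hrn)
        (hprod m r q n (hmq.trans hqr) (by lia) (hqr.trans hrn))))).false
  refine hM.not_ge ((v.map_sum_eq_of_lt (j := (k, l)) ?_ fun x hx => ?_).symm.trans_le
    (hsum k l hkl))
  · simpa using hkl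
  · obtain ⟨m, n⟩ := x
    simp only [Finset.mem_sdiff, Finset.mem_filter, Finset.mem_univ, true_and,
      Finset.mem_singleton, Prod.mk.injEq] at hx
    obtain ⟨⟨hmn, hs⟩, hne⟩ := hx
    refine (hle m n hmn).lt_of_ne fun heq => ?_
    rcases lt_trichotomy m k with h | rfl | h
    · exact nested m n k l h hkl (by lia) hs heq rfl
    · exact hne ⟨rfl, by lia⟩
    · exact nested k l m n h hmn (by lia) rfl rfl heq

/-- The sum of the brackets `[i j]` with `i < j` and `i + j = s`. -/
noncomputable def bracketSum (p s : ℕ) : Coord p :=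
  ∑ x : Fin p × Fin p with x.1 < x.2 ∧ x.1.val + x.2.val = s, bracket x.1 x.2

theorem bracketSum_mem_invariantRing (p s : ℕ) :
    bracketSum p s ∈ invariantRing (fun _ : Fin p => 1) :=
  Subalgebra.sum_mem _ fun _ _ => bracket_mem_invariantRing _ _

theorem isHomogeneous_bracketSum (p s : ℕ) : (bracketSum p s).IsHomogeneous 2 :=
  IsHomogeneous.sum _ _ _ fun _ _ =>
    ((isHomogeneous_X _ _).mul (isHomogeneous_X _ _)).sub
      ((isHomogeneous_X _ _).mul (isHomogeneous_X _ _))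

theorem isIntegral_bracket {p : ℕ} {R : Type*} [CommRing R] [Algebra R (Coord p)]
    (hinj : Function.Injective (algebraMap R (Coord p)))
    (hR : ∀ k : Fin (2 * p - 3), bracketSum p (k + 1) ∈ (algebraMap R (Coord p)).range)
    {i j : Fin p} (hij : i < j) : IsIntegral R (bracket i j) := by
  refine isIntegral_of_forall_valuationSubring hinj fun V hV => ?_
  rw [← V.valuation_le_one_iff]
  refine valuation_pluecker_le_one V.valuation
    (fun i j => algebraMap (Coord p) (FractionRing (Coord p)) (bracket i j)) ?_ ?_ ?_ hij
  · intro i j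
    rw [← map_neg]
    congr 1
    simp only [bracket]
    ring
  · intro i j k l
    simp only [← map_mul, ← map_sub]
    congr 1
    simp only [bracket]
    ring
  · intro k l hkl
    obtain ⟨r, hr⟩ := hR ⟨k + l - 1, by lia⟩
    rw [V.valuation_le_one_iff, ← map_sum]
    have := hV r
    rwa [hr, show k.val + l.val - 1 + 1 = k + l by lia] at this

theorem isIntegral_of_mem_invariantRing {p : ℕ} (hp : 2 ≤ p) {R : Type*} [CommRing R]
    [Algebra ℂ R] [Algebra R (Coord p)] [IsScalarTower ℂ R (Coord p)]
    (hinj : Function.Injective (algebraMap R (Coord p)))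
    (hR : ∀ k : Fin (2 * p - 3), bracketSum p (k + 1) ∈ (algebraMap R (Coord p)).range)
    {P : Coord p} (hP : P ∈ invariantRing (fun _ : Fin p => 1)) : IsIntegral R P := by
  rw [← bracketAlgebra_eq_invariantRing ⟨0, by lia⟩] at hP
  have : bracketAlgebra p ≤ (integralClosure R (Coord p)).restrictScalars ℂ := by
    refine Algebra.adjoin_le ?_
    rintro _ ⟨i, j, hij, rfl⟩
    exact isIntegral_bracket hinj hR hij
  exact this hP

/-- Specialization of the coordinates to the slice `ℓₐ = (1, 0)`, `ℓ_b = (0, s)`, with the first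
coefficients of the remaining forms divided by `s`. -/
noncomputable def slice {p : ℕ} (a b : Fin p) : Coord p →ₐ[ℂ] FractionRing (Coord p) :=
  aeval fun x =>
    if x.1 = a then if x.2 = 0 then 1 else 0
    else if x.2 = 1 then algebraMap (Coord p) _ (co x.1 1)
    else if x.1 = b then 0
    else algebraMap (Coord p) _ (co x.1 0) / algebraMap (Coord p) _ (co b 1)

/-- A bracket which restricts to the coordinate function `x` on the slice. -/
noncomputable def sliceBracket {p : ℕ} (a b : Fin p) (x : Idx (fun _ : Fin p => 1)) : Coord p :=
  if x.2 = 1 then bracket a x.1 else bracket x.1 b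

theorem slice_sliceBracket {p : ℕ} {a b : Fin p} (hab : a ≠ b) {x : Idx (fun _ : Fin p => 1)}
    (ha : x.1 ≠ a) (hb : x ≠ ⟨b, 0⟩) :
    slice a b (sliceBracket a b x) = algebraMap (Coord p) _ (X x) := by
  obtain ⟨m, n⟩ := x
  simp only at ha
  fin_cases n
  · have hb' : m ≠ b := by rintro rfl; exact hb rfl
    simp [sliceBracket, slice, bracket, co, ha, hb', hab.symm]
  · simp [sliceBracket, slice, bracket, co, ha]

theorem algebraicIndependent_sliceBracket {p : ℕ} {a b : Fin p} (hab : a ≠ b) :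
    AlgebraicIndependent ℂ
      fun x : {x : Idx (fun _ : Fin p => 1) // x.1 ≠ a ∧ x ≠ ⟨b, 0⟩} => sliceBracket a b x.1 := by
  refine AlgebraicIndependent.of_comp (slice a b) ?_
  have h := ((algebraicIndependent_X (Idx (fun _ : Fin p => 1)) ℂ).comp
    (Subtype.val : {x : Idx (fun _ : Fin p => 1) // x.1 ≠ a ∧ x ≠ ⟨b, 0⟩} → _)
    Subtype.val_injective).map' (f := IsScalarTower.toAlgHom ℂ (Coord p) (FractionRing (Coord p)))
    (IsFractionRing.injective _ _)
  convert h using 1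
  funext x
  exact slice_sliceBracket hab x.2.1 x.2.2

theorem card_slice {p : ℕ} {a b : Fin p} (hab : a ≠ b) :
    Fintype.card {x : Idx (fun _ : Fin p => 1) // x.1 ≠ a ∧ x ≠ ⟨b, 0⟩} = 2 * p - 3 := by
  have h : (Finset.univ.filter fun x : Idx (fun _ : Fin p => 1) => x.1 ≠ a ∧ x ≠ ⟨b, 0⟩) =
      ({⟨a, 0⟩, ⟨a, 1⟩, ⟨b, 0⟩} : Finset (Idx (fun _ : Fin p => 1)))ᶜ := by
    ext ⟨m, n⟩
    by_cases hm : m = a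
    · subst hm
      fin_cases n <;> simp
    · simp [hm]
  rw [Fintype.card_subtype, h, Finset.card_compl, Fintype.card_sigma]
  rw [Finset.card_eq_three.mpr ⟨_, _, _, ?_, ?_, ?_, rfl⟩]
  · simp [mul_comm]
  · simp
  · simp [hab]
  · simp [hab]

theorem le_trdeg_invariantRing {p : ℕ} (hp : 2 ≤ p) :
    ((2 * p - 3 : ℕ) : Cardinal) ≤ Algebra.trdeg ℂ (invariantRing (fun _ : Fin p => 1)) := by
  have hab : (⟨0, by lia⟩ : Fin p) ≠ ⟨1, by lia⟩ := by simp
  rw [← card_slice hab, ← Cardinal.mk_fintype]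
  refine AlgebraicIndependent.cardinalMk_le_trdeg (x := fun x =>
    (⟨sliceBracket _ _ x.1, ?_⟩ : invariantRing (fun _ : Fin p => 1)))
    (.of_comp (invariantRing (fun _ : Fin p => 1)).val (algebraicIndependent_sliceBracket hab))
  rw [sliceBracket]
  split_ifs <;> exact bracket_mem_invariantRing _ _

theorem algebraicIndependent_bracketSum {p : ℕ} (hp : 2 ≤ p) :
    AlgebraicIndependent ℂ fun k : Fin (2 * p - 3) => bracketSum p (k + 1) := by
  let Q (k : Fin (2 * p - 3)) : invariantRing (fun _ : Fin p => 1) :=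
    ⟨bracketSum p (k + 1), bracketSum_mem_invariantRing p _⟩
  have : Algebra.IsIntegral (Algebra.adjoin ℂ (Set.range Q))
      (invariantRing (fun _ : Fin p => 1)) := by
    refine ⟨fun x => ?_⟩
    rw [← isIntegral_algebraMap_iff (B := Coord p) Subtype.val_injective]
    exact isIntegral_of_mem_invariantRing hp
      (Subtype.val_injective.comp Subtype.val_injective)
      (fun k => ⟨⟨Q k, Algebra.subset_adjoin ⟨k, rfl⟩⟩, rfl⟩) x.2
  have : FaithfulSMul ℂ (invariantRing (fun _ : Fin p => 1)) :=
    (faithfulSMul_iff_algebraMap_injective _ _).mpr (RingHom.injective _)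
  have h : AlgebraicIndependent ℂ Q :=
    (Algebra.IsAlgebraic.isTranscendenceBasis_of_le_trdeg_of_finite ℂ Q
      (by simpa using le_trdeg_invariantRing hp)).1
  exact h.map' (f := (invariantRing (fun _ : Fin p => 1)).val) Subtype.val_injective

theorem isHSOP_bracketSum {p : ℕ} (hp : 2 ≤ p) :
    IsHSOP (fun _ : Fin p => 1) (fun k : Fin (2 * p - 3) => bracketSum p (k + 1))
      (fun _ => 2) :=
  ⟨fun _ => bracketSum_mem_invariantRing p _, fun _ => two_pos,
    fun _ => isHomogeneous_bracketSum p _, algebraicIndependent_bracketSum hp, fun _ hP =>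
      isIntegral_of_mem_invariantRing hp Subtype.val_injective
        (fun k => ⟨⟨_, Algebra.subset_adjoin ⟨k, rfl⟩⟩, rfl⟩) hP⟩

end BinInv

open BinInv in
/-- For `V = p·V₁` (`p ≥ 2`), the invariant ring is generated by the degree-2
invariants `(ℓᵢ,ℓⱼ)₁` for `i < j`, and it has a homogeneous system of parameters
consisting of `2p − 3` invariants of degree 2. -/
theorem pV1_generators_and_hsop (p : ℕ) (hp : 2 ≤ p) :
    Algebra.adjoin ℂ
        {P : MvPolynomial (Idx (fun _ : Fin p => 1)) ℂ |
          ∃ i j : Fin p, i < j ∧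
            P = constantCoeff
              (transvectant 1 1 1 (genForm (fun _ => 1) i) (genForm (fun _ => 1) j))} =
      invariantRing (fun _ : Fin p => 1) ∧
    ∃ Q : Fin (2 * p - 3) → MvPolynomial (Idx (fun _ : Fin p => 1)) ℂ,
      IsHSOP (fun _ : Fin p => 1) Q (fun _ => 2) := by
  refine ⟨?_, _, isHSOP_bracketSum hp⟩
  simp only [constantCoeff_transvectant_genForm]
  exact bracketAlgebra_eq_invariantRing ⟨0, by lia⟩
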